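/- arXiv:2507.13928 — 2 statements merged into one kernel-verified Lean document; each statement's English description precedes it below -/
import Mathlib

section
/- There exists a constant c > 0 such that for all f, h, n ≥ 0 and every regular word with constants w ∈ S_n ∗ F_r of length l < c·f^{1/2}/h, the probability over uniformly random (σ_1,...,σ_r) ∈ S_n^r that at least f points of {1,...,n} lie in cycles of length at most h of w(σ_1,...,σ_r) is at most exp(-c·f/(lh)²). -/
open Equiv Finset

/-- A word with constants `w = c_0 x_{ι(0)}^{ε(0)} c_1 ⋯ c_{l-1} x_{ι(l-1)}^{ε(l-1)} c_l`
in the free product `S_n ∗ F_r` (variables indexed from `0`). -/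
structure WordWC (n r : ℕ) where
  l : ℕ
  ι : Fin l → Fin r
  ε : Fin l → ℤ
  c : Fin (l + 1) → Equiv.Perm (Fin n)
  hε : ∀ j, ε j = 1 ∨ ε j = -1

namespace WordWC

variable {n r : ℕ}

/-- The word map `S_n^r → S_n` obtained from `w` by substitution. -/
def eval (w : WordWC n r) (σ : Fin r → Equiv.Perm (Fin n)) : Equiv.Perm (Fin n) :=
  w.c 0 * ((List.finRange w.l).map fun j => (σ (w.ι j)) ^ (w.ε j) * w.c j.succ).prod

/-- `j` is a critical index of `w`: the `j`-th and `(j+1)`-st variables agree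
and appear with opposite exponents. -/
def Critical (w : WordWC n r) (j : ℕ) (h : j + 1 < w.l) : Prop :=
  w.ι ⟨j, Nat.lt_of_succ_lt h⟩ = w.ι ⟨j + 1, h⟩ ∧
    w.ε ⟨j, Nat.lt_of_succ_lt h⟩ = -w.ε ⟨j + 1, h⟩

/-- `w` is reduced: every critical intermediate constant is non-central. -/
def Reduced (w : WordWC n r) : Prop :=
  ∀ (j : ℕ) (h : j + 1 < w.l), w.Critical j h →
    w.c ⟨j + 1, Nat.lt_succ_of_lt h⟩ ∉ Subgroup.center (Equiv.Perm (Fin n))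

/-- `w` is regular: `w` is not conjugate to an element of `S_n` (its length is
positive and cyclic reduction is impossible) and every critical constant of
`w²` is fixed point free.  The critical constants of `w²` are the critical
intermediate constants `c_{j+1}` of `w` together with, in case the junction
`x_{ι(l-1)}^{ε(l-1)} c_l c_0 x_{ι(0)}^{ε(0)}` is critical, the junction
constant `c_l c_0`. -/
def Regular (w : WordWC n r) : Prop :=
  0 < w.l ∧
  (∀ (j : ℕ) (h : j + 1 < w.l), w.Critical j h →
    ∀ x, w.c ⟨j + 1, Nat.lt_succ_of_lt h⟩ x ≠ x) ∧
  (∀ h : 0 < w.l,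
    (w.ι ⟨w.l - 1, Nat.sub_lt h Nat.one_pos⟩ = w.ι ⟨0, h⟩ ∧
      w.ε ⟨w.l - 1, Nat.sub_lt h Nat.one_pos⟩ = -w.ε ⟨0, h⟩) →
    ∀ x, (w.c (Fin.last w.l) * w.c 0) x ≠ x)

end WordWC

namespace WordWC

/-- Tuples of permutations consistent with the finite set `P` of constraints `σ i a = b`. -/
def cons {n r : ℕ} (P : Finset (Fin r × Fin n × Fin n)) : Finset (Fin r → Equiv.Perm (Fin n)) :=
  Finset.univ.filter fun σ => ∀ t ∈ P, σ t.1 t.2.1 = t.2.2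

/-- The answer to a query. -/
def ans {n : ℕ} (g : Equiv.Perm (Fin n)) (s : Bool) (q : Fin n) : Fin n :=
  if s then g q else g⁻¹ q

/-- The constraint recording that a query `q` has answer `z`. -/
def tri {n r : ℕ} (i : Fin r) (s : Bool) (q z : Fin n) : Fin r × Fin n × Fin n :=
  if s then (i, q, z) else (i, z, q)

theorem mem_cons {n r : ℕ} {P : Finset (Fin r × Fin n × Fin n)}
    {σ : Fin r → Equiv.Perm (Fin n)} :
    σ ∈ cons P ↔ ∀ t ∈ P, σ t.1 t.2.1 = t.2.2 := by
  simp [cons]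

theorem mem_cons_insert {n r : ℕ} {P : Finset (Fin r × Fin n × Fin n)}
    {σ : Fin r → Equiv.Perm (Fin n)} {i : Fin r} {s : Bool} {q z : Fin n} :
    σ ∈ cons (insert (tri i s q z) P) ↔ σ ∈ cons P ∧ ans (σ i) s q = z := by
  simp only [mem_cons, Finset.forall_mem_insert]
  cases s
  · simp only [tri, ans, Bool.false_eq_true, if_false]
    rw [Equiv.Perm.inv_eq_iff_eq]
    tauto
  · simp only [tri, ans, if_true]
    tauto

theorem card_cons_insert {n r : ℕ} (P : Finset (Fin r × Fin n × Fin n))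
    (t : Fin r × Fin n × Fin n) (ht : t ∉ P) :
    (n - P.card) * (cons (insert t P)).card ≤ (cons P).card := by
  obtain ⟨i, a, b⟩ := t
  set Q : Finset (Fin n) := Finset.univ \ P.image (fun t => t.2.2) with hQ
  have hQc : n - P.card ≤ Q.card := by
    have h1 : (P.image (fun t => t.2.2)).card ≤ P.card := Finset.card_image_le
    rw [hQ, Finset.card_sdiff_of_subset (Finset.subset_univ _), Finset.card_univ, Fintype.card_fin]
    omega
  calc (n - P.card) * (cons (insert (i, a, b) P)).card
      ≤ Q.card * (cons (insert (i, a, b) P)).card := Nat.mul_le_mul_right _ hQc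
    _ = (Q ×ˢ cons (insert (i, a, b) P)).card := (Finset.card_product _ _).symm
    _ ≤ (cons P).card := by
      apply Finset.card_le_card_of_injOn
        (fun p => Function.update p.2 i (Equiv.swap b p.1 * p.2 i))
      · rintro ⟨b', σ⟩ hp
        have hp' := Finset.mem_product.1 (Finset.mem_coe.1 hp)
        obtain ⟨hb', hσ⟩ := hp'
        simp only [mem_cons, Finset.forall_mem_insert] at hσ
        obtain ⟨hab, hσ⟩ := hσ
        apply Finset.mem_coe.2
        rw [mem_cons]
        rintro ⟨i', a', b''⟩ ht'
        have h1 := hσ _ ht'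
        simp only at h1 hab hb' ⊢
        by_cases hi : i' = i
        · subst hi
          rw [Function.update_self, Equiv.Perm.mul_apply, h1]
          apply Equiv.swap_apply_of_ne_of_ne
          · rintro rfl
            have : a' = a := (σ i').injective (h1.trans hab.symm)
            subst this
            exact ht ht'
          · rintro rfl
            rw [hQ, Finset.mem_sdiff] at hb'
            exact hb'.2 (Finset.mem_image.2 ⟨_, ht', rfl⟩)
        · rw [Function.update_of_ne hi, h1]
      · rintro ⟨b1, σ1⟩ h1 ⟨b2, σ2⟩ h2 h
        have h1' := (Finset.mem_product.1 (Finset.mem_coe.1 h1)).2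
        have h2' := (Finset.mem_product.1 (Finset.mem_coe.1 h2)).2
        simp only [mem_cons, Finset.forall_mem_insert] at h1' h2' h
        have hi := congrFun h i
        rw [Function.update_self, Function.update_self] at hi
        have hb : b1 = b2 := by
          have := congrArg (fun g : Equiv.Perm (Fin n) => g a) hi
          simpa [h1'.1, h2'.1] using this
        subst hb
        have hs : σ1 = σ2 := by
          funext k
          by_cases hk : k = i
          · subst hk
            exact mul_left_cancel hi
          · have := congrFun h k
            rwa [Function.update_of_ne hk, Function.update_of_ne hk] at this
        rw [hs]

/-- The walk of query points. -/
def walk {n r : ℕ} (ι : ℕ → Fin r) (s : ℕ → Bool) (d : ℕ → Equiv.Perm (Fin n))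
    (σ : Fin r → Equiv.Perm (Fin n)) (y : Fin n) : ℕ → Fin n
  | 0 => y
  | j + 1 => d j (ans (σ (ι j)) (s j) (walk ι s d σ y j))

/-- The walk from `y` returns to `y` within `L` steps. -/
def Short {n r : ℕ} (ι : ℕ → Fin r) (s : ℕ → Bool) (d : ℕ → Equiv.Perm (Fin n)) (L : ℕ)
    (σ : Fin r → Equiv.Perm (Fin n)) (y : Fin n) : Prop :=
  ∃ i, 0 < i ∧ i ≤ L ∧ walk ι s d σ y i = y

/-- Points at which a query is already answered. -/
theorem card_known {n r : ℕ} (P : Finset (Fin r × Fin n × Fin n)) (i : Fin r) (s : Bool) :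
    ∃ K : Finset (Fin n), K.card ≤ P.card ∧ ∀ q z, tri i s q z ∈ P → q ∈ K := by
  refine ⟨P.image (fun t => if s then t.2.1 else t.2.2), Finset.card_image_le, ?_⟩
  intro q z h
  refine Finset.mem_image.2 ⟨_, h, ?_⟩
  cases s <;> simp [tri]

open Classical in
theorem inner {n r : ℕ} (ι : ℕ → Fin r) (s : ℕ → Bool) (d : ℕ → Equiv.Perm (Fin n)) (L : ℕ)
    (hreg : ∀ j, ι j = ι (j + 1) → s j ≠ s (j + 1) → ∀ x, d j x ≠ x)
    (X : (Fin r → Equiv.Perm (Fin n)) → ℝ) (hX : ∀ σ, 0 ≤ X σ) (M : ℕ) (β δ D : ℝ) (hβ : 0 ≤ β)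
    (hD : (M : ℝ) + 2 ≤ D)
    (hIH : ∀ P : Finset (Fin r × Fin n × Fin n), P.card ≤ M →
      ∑ σ ∈ cons P, X σ ≤ β * (cons P).card)
    (hδ0 : 0 ≤ δ)
    (hδ : ∀ (P : Finset (Fin r × Fin n × Fin n)) t, P.card ≤ M → t ∉ P →
      ((cons (insert t P)).card : ℝ) ≤ δ * (cons P).card)
    (y : Fin n) :
    ∀ (m j : ℕ) (P : Finset (Fin r × Fin n × Fin n)) (q : Fin n), j + m = L →
      P.card + m ≤ M → (∀ σ ∈ cons P, walk ι s d σ y j = q) →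
      (∀ σ ∈ cons P, ∀ i, 0 < i → i ≤ j → walk ι s d σ y i ≠ y) →
      (∀ z, tri (ι j) (s j) q z ∉ P) →
      ∑ σ ∈ (cons P).filter (fun σ => Short ι s d L σ y), X σ
        ≤ m * (D * δ) * (β * (cons P).card) := by
  intro m
  induction m with
  | zero =>
    intro j P q hj _ _ hne _
    rw [Finset.sum_eq_zero]
    · simp
    · intro σ hσ
      obtain ⟨hσ, i, hi0, hiL, hi⟩ := Finset.mem_filter.1 hσ
      exact absurd hi (hne σ hσ i hi0 (by omega))
  | succ m ih =>
    intro j P q hj hPm hq hne hfree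
    set P' : Fin n → Finset (Fin r × Fin n × Fin n) := fun z => insert (tri (ι j) (s j) q z) P
      with hP'
    have hfib : ∀ (p : (Fin r → Equiv.Perm (Fin n)) → Prop) (Y : (Fin r → Equiv.Perm (Fin n)) → ℝ),
        ∑ σ ∈ (cons P).filter p, Y σ = ∑ z, ∑ σ ∈ (cons (P' z)).filter p, Y σ := by
      intro p Y
      rw [← Finset.sum_fiberwise _ (fun σ => ans (σ (ι j)) (s j) q)]
      apply Finset.sum_congr rfl
      intro z _
      apply Finset.sum_congr _ (fun _ _ => rfl)
      ext σ
      simp only [Finset.mem_filter, hP', mem_cons_insert]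
      tauto
    have hcard : ((cons P).card : ℝ) = ∑ z, ((cons (P' z)).card : ℝ) := by
      have := hfib (fun _ => True) (fun _ => 1)
      simpa using this
    have hP'c : ∀ z, (P' z).card ≤ P.card + 1 := fun z => Finset.card_insert_le _ _
    obtain ⟨K, hKc, hK⟩ := card_known P (ι (j + 1)) (s (j + 1))
    set bad : Finset (Fin n) := (insert y (insert q K)).image (fun u => (d j)⁻¹ u) with hbad
    have hbadc : (bad.card : ℝ) ≤ D := by
      have h1 : bad.card ≤ K.card + 2 := by
        refine Finset.card_image_le.trans ((Finset.card_insert_le _ _).trans ?_)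
        have := Finset.card_insert_le q K
        omega
      have h2 : bad.card ≤ M + 2 := by omega
      have h3 : (bad.card : ℝ) ≤ (M : ℝ) + 2 := by exact_mod_cast h2
      linarith
    have hgood : ∀ z, z ∉ bad → d j z ≠ y ∧ d j z ≠ q ∧ d j z ∉ K := by
      intro z hz
      have : ∀ u, u ∈ insert y (insert q K) → d j z ≠ u := by
        rintro u hu rfl
        exact hz (Finset.mem_image.2 ⟨_, hu, by simp⟩)
      refine ⟨this _ (by simp), this _ (by simp), fun h => this _ (by simp [h]) rfl⟩
    have hD0 : 0 ≤ D := by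
      have : (0:ℝ) ≤ M := Nat.cast_nonneg _
      linarith
    have hterm : ∀ z, ∑ σ ∈ (cons (P' z)).filter (fun σ => Short ι s d L σ y), X σ ≤
        (if z ∈ bad then β * (δ * (cons P).card) else 0) +
          m * (D * δ) * (β * (cons (P' z)).card) := by
      intro z
      by_cases hz : z ∈ bad
      · rw [if_pos hz]
        have h1 : ∑ σ ∈ (cons (P' z)).filter (fun σ => Short ι s d L σ y), X σ ≤
            ∑ σ ∈ cons (P' z), X σ :=
          Finset.sum_le_sum_of_subset_of_nonneg (Finset.filter_subset _ _) (fun _ _ _ => hX _)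
        have h2 := hIH (P' z) (by have := hP'c z; omega)
        have h3 := mul_le_mul_of_nonneg_left (hδ P (tri (ι j) (s j) q z) (by omega) (hfree z)) hβ
        have h4 : 0 ≤ (m:ℝ) * (D * δ) * (β * (cons (P' z)).card) := by positivity
        simp only [hP'] at h1 h2 h4 ⊢
        linarith
      · rw [if_neg hz, zero_add]
        obtain ⟨hg1, hg2, hg3⟩ := hgood z hz
        have hw : ∀ σ ∈ cons (P' z), walk ι s d σ y (j + 1) = d j z := by
          intro σ hσ
          rw [hP', mem_cons_insert] at hσ
          rw [walk, hq σ hσ.1, hσ.2]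
        apply ih (j + 1) (P' z) (d j z) (by omega) (by have := hP'c z; omega) hw
        · intro σ hσ i hi0 hij
          rcases Nat.lt_or_ge j i with h | h
          · obtain rfl : i = j + 1 := by omega
            rw [hw σ hσ]
            exact hg1
          · exact hne σ (mem_cons_insert.1 hσ).1 i hi0 h
        · intro z' hz'
          rcases Finset.mem_insert.1 hz' with h | h
          · have hι : ι j = ι (j + 1) := by
              have := congrArg Prod.fst h
              cases h1 : s (j + 1) <;> cases h2 : s j <;> simp [tri, h1, h2] at this <;> exact this.symm
            by_cases hs : s j = s (j + 1)
            · rw [← hs] at h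
              cases h2 : s j <;> simp [tri, h2] at h
              · exact hg2 h.2.2
              · exact hg2 h.2.1
            · have hf := hreg j hι hs z
              cases h1 : s (j + 1) <;> cases h2 : s j <;> simp [tri, h1, h2] at h hs
              · exact hf h.2.2
              · exact hf h.2.1
          · exact hg3 (hK _ _ h)
    rw [hfib]
    calc _ ≤ ∑ z, ((if z ∈ bad then β * (δ * (cons P).card) else 0) +
          m * (D * δ) * (β * (cons (P' z)).card)) := Finset.sum_le_sum (fun z _ => hterm z)
      _ = bad.card * (β * (δ * (cons P).card)) + m * (D * δ) * (β * (cons P).card) := by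
        rw [Finset.sum_add_distrib, hcard, ← Finset.mul_sum, ← Finset.mul_sum]
        congr 1
        simp
      _ ≤ D * (β * (δ * (cons P).card)) + m * (D * δ) * (β * (cons P).card) := by
        gcongr
      _ = _ := by push_cast; ring

open Classical in
theorem outer {n r : ℕ} (ι : ℕ → Fin r) (s : ℕ → Bool) (d : ℕ → Equiv.Perm (Fin n)) (L : ℕ)
    (hL : 0 < L)
    (hreg : ∀ j, ι j = ι (j + 1) → s j ≠ s (j + 1) → ∀ x, d j x ≠ x)
    (M : ℕ) (hM : 2 * M ≤ n) :
    ∀ (k : ℕ) (P : Finset (Fin r × Fin n × Fin n)), P.card + k * L ≤ M →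
      ∑ σ ∈ cons P, ((Finset.univ.filter (fun y => Short ι s d L σ y)).card : ℝ) ^ k
        ≤ ((M : ℝ) + 2 * L * (M + 2)) ^ k * (cons P).card := by
  intro k
  induction k with
  | zero => intro P _; simp
  | succ k ih =>
    intro P hP
    set B : ℝ := (M : ℝ) + 2 * L * (M + 2) with hB
    have hB0 : 0 ≤ B := by positivity
    set X : (Fin r → Equiv.Perm (Fin n)) → ℝ := fun σ =>
      ((Finset.univ.filter (fun y => Short ι s d L σ y)).card : ℝ) ^ k with hXdef
    have hX : ∀ σ, 0 ≤ X σ := fun σ => by positivity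
    have hkL : (k + 1) * L = k * L + L := by ring
    have hn : 0 < n := by omega
    have hδ : ∀ (P : Finset (Fin r × Fin n × Fin n)) t, P.card ≤ M - k * L → t ∉ P →
        ((cons (insert t P)).card : ℝ) ≤ 2 / n * (cons P).card := by
      intro P t hPc ht
      have h1 := card_cons_insert P t ht
      have h2 : n ≤ 2 * (n - P.card) := by omega
      have h3 : n * (cons (insert t P)).card ≤ 2 * (cons P).card := by
        calc _ ≤ 2 * (n - P.card) * (cons (insert t P)).card := Nat.mul_le_mul_right _ h2
          _ = 2 * ((n - P.card) * (cons (insert t P)).card) := by ring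
          _ ≤ _ := Nat.mul_le_mul_left _ h1
      have h4 : (n : ℝ) * (cons (insert t P)).card ≤ 2 * (cons P).card := by exact_mod_cast h3
      rw [div_mul_eq_mul_div, le_div_iff₀ (by exact_mod_cast hn)]
      linarith
    obtain ⟨K, hKc, hK⟩ := card_known P (ι 0) (s 0)
    have hy : ∀ y, ∑ σ ∈ (cons P).filter (fun σ => Short ι s d L σ y), X σ ≤
        (if y ∈ K then B ^ k * (cons P).card else 0) +
          L * ((M + 2) * (2 / n)) * (B ^ k * (cons P).card) := by
      intro y
      by_cases hyK : y ∈ K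
      · rw [if_pos hyK]
        have h1 : ∑ σ ∈ (cons P).filter (fun σ => Short ι s d L σ y), X σ ≤
            ∑ σ ∈ cons P, X σ :=
          Finset.sum_le_sum_of_subset_of_nonneg (Finset.filter_subset _ _) (fun _ _ _ => hX _)
        have h2 := ih P (by omega)
        have h4 : 0 ≤ (L:ℝ) * (((M:ℝ) + 2) * (2 / n)) * (B ^ k * (cons P).card) := by positivity
        linarith
      · rw [if_neg hyK, zero_add]
        refine inner ι s d L hreg X hX (M - k * L) (B ^ k) (2 / n) (M + 2) (by positivity) ?_ ?_
          (by positivity) hδ y L 0 P y (by omega) (by omega) ?_ ?_ ?_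
        · have : ((M - k * L : ℕ) : ℝ) ≤ M := by exact_mod_cast Nat.sub_le _ _
          linarith
        · intro P hP
          exact ih P (by omega)
        · intro σ _; rfl
        · intro σ _ i h1 h2; omega
        · intro z hz; exact hyK (hK _ _ hz)
    calc ∑ σ ∈ cons P, ((Finset.univ.filter (fun y => Short ι s d L σ y)).card : ℝ) ^ (k + 1)
        = ∑ σ ∈ cons P, ∑ y, if Short ι s d L σ y then X σ else 0 := by
          apply Finset.sum_congr rfl
          intro σ _
          rw [← Finset.sum_filter, Finset.sum_const, nsmul_eq_mul, pow_succ, mul_comm]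
      _ = ∑ y, ∑ σ ∈ (cons P).filter (fun σ => Short ι s d L σ y), X σ := by
          rw [Finset.sum_comm]
          apply Finset.sum_congr rfl
          intro y _
          rw [Finset.sum_filter]
      _ ≤ ∑ y, ((if y ∈ K then B ^ k * (cons P).card else 0) +
          L * ((M + 2) * (2 / n)) * (B ^ k * (cons P).card)) :=
          Finset.sum_le_sum (fun y _ => hy y)
      _ = K.card * (B ^ k * (cons P).card) +
          n * (L * ((M + 2) * (2 / n)) * (B ^ k * (cons P).card)) := by
          rw [Finset.sum_add_distrib]
          simp
      _ ≤ M * (B ^ k * (cons P).card) +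
          n * (L * ((M + 2) * (2 / n)) * (B ^ k * (cons P).card)) := by
          have : K.card ≤ M := by omega
          gcongr
      _ = _ := by
          have : (n : ℝ) ≠ 0 := by positivity
          rw [hB]
          field_simp
          ring

variable {n r : ℕ}

/-- The letter index used at step `i`. -/
def idx (w : WordWC n r) (i : ℕ) : ℕ := w.l - 1 - i % w.l

theorem idx_lt (w : WordWC n r) (hl : 0 < w.l) (i : ℕ) : w.idx i < w.l := by
  unfold idx; omega

/-- Constants used in the walk. -/
def dd (w : WordWC n r) (i : ℕ) : Equiv.Perm (Fin n) :=
  if w.idx i = 0 then w.c (Fin.last w.l) * w.c 0 else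
    w.c ⟨w.idx i, by unfold idx; omega⟩

/-- Signs used in the walk. -/
def ss (w : WordWC n r) (hl : 0 < w.l) (i : ℕ) : Bool :=
  decide (w.ε ⟨w.idx i, w.idx_lt hl i⟩ = 1)

/-- Variables used in the walk. -/
def ii (w : WordWC n r) (hl : 0 < w.l) (i : ℕ) : Fin r := w.ι ⟨w.idx i, w.idx_lt hl i⟩

theorem eps_of_ss (w : WordWC n r) (hl : 0 < w.l) {i j : ℕ} (h : w.ss hl i ≠ w.ss hl j) :
    w.ε ⟨w.idx i, w.idx_lt hl i⟩ = - w.ε ⟨w.idx j, w.idx_lt hl j⟩ := by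
  unfold ss at h
  rcases w.hε ⟨w.idx i, w.idx_lt hl i⟩ with h1 | h1 <;>
    rcases w.hε ⟨w.idx j, w.idx_lt hl j⟩ with h2 | h2 <;> simp_all

theorem reg_walk (w : WordWC n r) (hw : w.Regular) (j : ℕ)
    (hι : w.ii hw.1 j = w.ii hw.1 (j + 1)) (hs : w.ss hw.1 j ≠ w.ss hw.1 (j + 1)) (x : Fin n) :
    w.dd j x ≠ x := by
  obtain ⟨hl, h1, h2⟩ := hw
  have he := w.eps_of_ss hl hs
  have hmod : j % w.l < w.l := Nat.mod_lt _ hl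
  unfold ii at hι
  unfold dd
  by_cases h0 : w.idx j = 0
  · rw [if_pos h0]
    have h3 : w.idx (j + 1) = w.l - 1 := by
      have h4 : (j + 1) % w.l = 0 := by
        have : j % w.l = w.l - 1 := by unfold idx at h0; omega
        rw [Nat.add_mod, this]
        rcases Nat.lt_or_ge 1 w.l with h | h
        · rw [Nat.mod_eq_of_lt h, Nat.sub_add_cancel (by omega), Nat.mod_self]
        · obtain h : w.l = 1 := by omega
          rw [h]
      unfold idx; rw [h4]; rfl
    simp only [h0, h3] at hι he
    exact h2 hl ⟨hι.symm, by rw [he, neg_neg]⟩ x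
  · rw [if_neg h0]
    have h4 : (j + 1) % w.l = j % w.l + 1 := by
      unfold idx at h0
      rw [Nat.add_mod, Nat.mod_eq_of_lt (a := 1) (by omega), Nat.mod_eq_of_lt (by omega)]
    obtain ⟨p, hp⟩ : ∃ p, w.idx j = p + 1 := ⟨w.idx j - 1, by omega⟩
    have hp' : w.idx (j + 1) = p := by
      unfold idx at hp ⊢
      omega
    have hpl : p + 1 < w.l := by rw [← hp]; exact w.idx_lt hl j
    simp only [hp, hp'] at hι he ⊢
    exact h1 p hpl ⟨hι.symm, by rw [he, neg_neg]⟩ x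

/-- The factors of the word. -/
def gg (w : WordWC n r) (σ : Fin r → Equiv.Perm (Fin n)) (j : ℕ) : Equiv.Perm (Fin n) :=
  if h : j < w.l then (σ (w.ι ⟨j, h⟩)) ^ (w.ε ⟨j, h⟩) * w.c ⟨j + 1, by omega⟩ else 1

theorem eval_eq (w : WordWC n r) (σ : Fin r → Equiv.Perm (Fin n)) :
    w.eval σ = w.c 0 * ((List.range' 0 w.l).map (w.gg σ)).prod := by
  unfold eval
  congr 2
  rw [← List.range_eq_range', ← List.map_coe_finRange_eq_range, List.map_map]
  apply List.map_congr_left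
  intro j _
  simp [gg, Fin.succ]

theorem ans_eq (w : WordWC n r) (hl : 0 < w.l) (σ : Fin r → Equiv.Perm (Fin n)) (i : ℕ)
    (q : Fin n) :
    ans (σ (w.ii hl i)) (w.ss hl i) q =
      ((σ (w.ι ⟨w.idx i, w.idx_lt hl i⟩)) ^ (w.ε ⟨w.idx i, w.idx_lt hl i⟩)) q := by
  unfold ans ss ii
  rcases w.hε ⟨w.idx i, w.idx_lt hl i⟩ with h | h <;> simp [h]

theorem walk_partial (w : WordWC n r) (hl : 0 < w.l) (σ : Fin r → Equiv.Perm (Fin n))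
    (x x' : Fin n) (m : ℕ)
    (h0 : walk (w.ii hl) (w.ss hl) w.dd σ x (w.l * m) = w.c (Fin.last w.l) x') :
    ∀ i (hi : i < w.l), walk (w.ii hl) (w.ss hl) w.dd σ x (w.l * m + i) =
      w.c ⟨w.l - i, by omega⟩ (((List.range' (w.l - i) i).map (w.gg σ)).prod x') := by
  intro i
  induction i with
  | zero =>
    intro _
    simpa [Fin.last] using h0
  | succ i ih =>
    intro hi
    have hidx : w.idx (w.l * m + i) = w.l - (i + 1) := by
      unfold idx
      rw [Nat.mul_add_mod, Nat.mod_eq_of_lt (by omega)]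
      omega
    rw [← Nat.add_assoc, walk, ih (by omega), ans_eq]
    have h1 : w.l - i = w.l - (i + 1) + 1 := by omega
    have h2 : w.l - (i + 1) < w.l := by omega
    rw [List.range'_succ, List.map_cons, List.prod_cons, Equiv.Perm.mul_apply]
    have hg : w.gg σ (w.l - (i + 1)) = (σ (w.ι ⟨w.l - (i + 1), h2⟩)) ^ (w.ε ⟨w.l - (i + 1), h2⟩)
        * w.c ⟨w.l - (i + 1) + 1, by omega⟩ := by
      unfold gg
      rw [dif_pos h2]
    rw [hg, Equiv.Perm.mul_apply]
    have hd : w.dd (w.l * m + i) = w.c ⟨w.l - (i + 1), by omega⟩ := by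
      unfold dd
      rw [if_neg (by omega)]
      simp only [hidx]
    rw [hd]
    simp only [hidx, h1]

theorem walk_mul (w : WordWC n r) (hl : 0 < w.l) (σ : Fin r → Equiv.Perm (Fin n))
    (x : Fin n) (m : ℕ) :
    walk (w.ii hl) (w.ss hl) w.dd σ (w.c (Fin.last w.l) x) (w.l * m) =
      w.c (Fin.last w.l) ((⇑(w.eval σ))^[m] x) := by
  induction m with
  | zero => rfl
  | succ m ih =>
    have h := w.walk_partial hl σ _ _ m ih (w.l - 1) (by omega)
    have hidx : w.idx (w.l * m + (w.l - 1)) = 0 := by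
      unfold idx
      rw [Nat.mul_add_mod, Nat.mod_eq_of_lt (by omega)]
      omega
    have h1 : w.l * (m + 1) = w.l * m + (w.l - 1) + 1 := by
      rw [Nat.mul_add]; omega
    have h2 : w.l - (w.l - 1) = 1 := by omega
    rw [h1, walk, h, ans_eq, Function.iterate_succ_apply', eval_eq w σ]
    obtain ⟨p, hp⟩ : ∃ p, w.l = p + 1 := ⟨w.l - 1, by omega⟩
    have hr : List.range' 0 w.l = 0 :: List.range' 1 (w.l - 1) := by
      rw [hp, List.range'_succ]; rfl
    rw [hr, List.map_cons, List.prod_cons]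
    have hg : w.gg σ 0 = (σ (w.ι ⟨0, hl⟩)) ^ (w.ε ⟨0, hl⟩) * w.c ⟨0 + 1, by omega⟩ := by
      unfold gg
      rw [dif_pos hl]
    have hd : w.dd (w.l * m + (w.l - 1)) = w.c (Fin.last w.l) * w.c 0 := by
      unfold dd
      rw [if_pos hidx]
    rw [hg, hd]
    simp only [Equiv.Perm.mul_apply, hidx, h2]

open Classical in
theorem ncard_le_short (w : WordWC n r) (hl : 0 < w.l) (h : ℕ) (σ : Fin r → Equiv.Perm (Fin n)) :
    {x : Fin n | Function.minimalPeriod (⇑(w.eval σ)) x ≤ h}.ncard ≤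
      (Finset.univ.filter
        (fun y => Short (w.ii hl) (w.ss hl) w.dd (w.l * h) σ y)).card := by
  rw [← Set.ncard_coe_finset]
  apply Set.ncard_le_ncard_of_injOn (fun x => w.c (Fin.last w.l) x)
  · intro x hx
    have hx' : Function.minimalPeriod (⇑(w.eval σ)) x ≤ h := hx
    have hpos : 0 < Function.minimalPeriod (⇑(w.eval σ)) x :=
      Function.minimalPeriod_pos_of_mem_periodicPts
        ((w.eval σ).injective.mem_periodicPts x)
    simp only [Finset.coe_filter, Finset.mem_univ, true_and, Set.mem_setOf_eq]
    refine ⟨w.l * Function.minimalPeriod (⇑(w.eval σ)) x, Nat.mul_pos hl hpos,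
      Nat.mul_le_mul_left _ hx', ?_⟩
    rw [walk_mul, Function.iterate_minimalPeriod]
  · intro a _ b _ hab
    exact (w.c (Fin.last w.l)).injective hab

end WordWC

/-- There is a constant `c > 0` such that for all `f, h, n ≥ 0` and every
regular word with constants `w ∈ S_n ∗ F_r` of length `l < c·f^{1/2}/h`, the
probability over uniformly random `(σ_1,…,σ_r) ∈ S_n^r` that at least `f`
points of `{1,…,n}` lie in cycles of length at most `h` of `w(σ_1,…,σ_r)` is
at most `exp(-c·f/(lh)²)`. -/
theorem stmt18 : ∃ c : ℝ, 0 < c ∧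
    ∀ (r f h n : ℕ) (w : WordWC n r), w.Reduced → w.Regular →
      (w.l : ℝ) < c * Real.sqrt f / h →
      ({σ : Fin r → Equiv.Perm (Fin n) |
          f ≤ {x : Fin n |
            Function.minimalPeriod (⇑(w.eval σ)) x ≤ h}.ncard}.ncard : ℝ) /
        ((n.factorial : ℝ) ^ r) ≤
        Real.exp (-(c * f) / ((w.l : ℝ) * h) ^ 2) := by
  refine ⟨1 / 42, by norm_num, ?_⟩
  intro r f h n w _ hreg hlen
  classical
  have hl : 0 < w.l := hreg.1
  have hh : 0 < h := by
    rcases Nat.eq_zero_or_pos h with rfl | h0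
    · exfalso
      have : (0:ℝ) ≤ w.l := Nat.cast_nonneg _
      simp at hlen
      linarith
    · exact h0
  set L : ℕ := w.l * h with hLdef
  have hL : 0 < L := Nat.mul_pos hl hh
  have hLR : (1:ℝ) ≤ L := by exact_mod_cast hL
  have hcast : (w.l : ℝ) * h = L := by rw [hLdef]; push_cast; ring
  have hhR : (0:ℝ) < h := by exact_mod_cast hh
  rw [lt_div_iff₀ hhR, hcast] at hlen
  have hf0 : (0:ℝ) ≤ f := Nat.cast_nonneg _
  have hLf : 1764 * (L:ℝ) ^ 2 < f := by
    have h1 := Real.sq_sqrt hf0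
    nlinarith [Real.sqrt_nonneg (f:ℝ)]
  rw [hcast]
  set E : Set (Fin r → Equiv.Perm (Fin n)) := {σ | f ≤ {x : Fin n |
            Function.minimalPeriod (⇑(w.eval σ)) x ≤ h}.ncard} with hE
  by_cases hfn : n < f
  · have : E = ∅ := by
      rw [Set.eq_empty_iff_forall_notMem]
      intro σ hσ
      have h1 : f ≤ {x : Fin n | Function.minimalPeriod (⇑(w.eval σ)) x ≤ h}.ncard := hσ
      have h2 := Set.ncard_le_card {x : Fin n | Function.minimalPeriod (⇑(w.eval σ)) x ≤ h}
      simp at h2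
      omega
    rw [this]
    simp [Real.exp_nonneg]
  have hfn' : f ≤ n := by omega
  set K : ℕ := f / (21 * L ^ 2) with hK
  have hK1 : K * (21 * L ^ 2) ≤ f := Nat.div_mul_le_self _ _
  have hK1R : (K:ℝ) * (21 * L ^ 2) ≤ f := by exact_mod_cast hK1
  have hK2 : (f:ℝ) < (K + 1) * (21 * L ^ 2) := by
    have : f < (K + 1) * (21 * L ^ 2) := by
      rw [hK]
      have h2 := Nat.div_add_mod f (21 * L ^ 2)
      have h3 := Nat.mod_lt f (show 21 * L ^ 2 > 0 by positivity)
      nlinarith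
    exact_mod_cast this
  have hL2 : (1:ℝ) ≤ (L:ℝ) ^ 2 := one_le_pow₀ hLR
  have hKpos : (1:ℝ) ≤ K := by
    have : 1 ≤ K := by
      rw [hK, Nat.one_le_div_iff (by positivity)]
      have : 1764 * L ^ 2 < f := by exact_mod_cast hLf
      omega
    exact_mod_cast this
  have hM : 2 * (K * L) ≤ n := by nlinarith
  have hmain := WordWC.outer (w.ii hl) (w.ss hl) w.dd L hL (fun j => w.reg_walk hreg j)
    (K * L) hM K ∅ (by simp)
  have hcons : ((WordWC.cons (∅ : Finset (Fin r × Fin n × Fin n))).card : ℝ) =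
      (n.factorial : ℝ) ^ r := by
    simp [WordWC.cons, Fintype.card_perm]
  rw [hcons] at hmain
  have hB : ((K * L : ℕ) : ℝ) + 2 * L * ((K * L : ℕ) + 2) ≤ f / 3 := by
    push_cast
    have : (K:ℝ) * L ≤ K * L ^ 2 := by nlinarith
    have : (L:ℝ) ≤ K * L ^ 2 := by nlinarith
    nlinarith
  have hlow : (E.ncard : ℝ) * (f:ℝ) ^ K ≤ ∑ σ ∈ WordWC.cons (∅ : Finset (Fin r × Fin n × Fin n)),
      ((Finset.univ.filter
        (fun y => WordWC.Short (w.ii hl) (w.ss hl) w.dd L σ y)).card : ℝ) ^ K := by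
    have h1 : E.ncard = (Finset.univ.filter (fun σ => σ ∈ E)).card := by
      rw [← Set.ncard_coe_finset]; simp
    rw [h1, ← nsmul_eq_mul, ← Finset.sum_const]
    refine (Finset.sum_le_sum (g := fun σ => ((Finset.univ.filter
        (fun y => WordWC.Short (w.ii hl) (w.ss hl) w.dd L σ y)).card : ℝ) ^ K) ?_).trans
      (Finset.sum_le_sum_of_subset_of_nonneg ?_ ?_)
    · intro σ hσ
      have h2 : f ≤ _ := (Finset.mem_filter.1 hσ).2
      have h3 := h2.trans (w.ncard_le_short hl h σ)
      have h4 : (f : ℝ) ≤ _ := Nat.cast_le.2 h3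
      exact pow_le_pow_left₀ hf0 h4 K
    · intro σ _
      simp [WordWC.mem_cons]
    · intro σ _ _
      positivity
  have hfpos : (0:ℝ) < f := by nlinarith
  have hfac : (0:ℝ) < (n.factorial : ℝ) ^ r := by positivity
  have hprob : (E.ncard : ℝ) / (n.factorial : ℝ) ^ r ≤ (1 / 3) ^ K := by
    rw [div_le_iff₀ hfac]
    have h1 : (((K * L : ℕ) : ℝ) + 2 * L * ((K * L : ℕ) + 2)) ^ K ≤ (f / 3) ^ K :=
      pow_le_pow_left₀ (by positivity) hB K
    have h2 : (E.ncard : ℝ) * (f:ℝ) ^ K ≤ ((1 / 3) ^ K * (n.factorial : ℝ) ^ r) * (f:ℝ) ^ K := by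
      calc _ ≤ _ := hlow
        _ ≤ _ := hmain
        _ ≤ (f / 3) ^ K * (n.factorial : ℝ) ^ r := by gcongr
        _ = _ := by rw [show (f:ℝ) / 3 = 1 / 3 * f by ring, mul_pow]; ring
    exact le_of_mul_le_mul_right h2 (by positivity)
  refine hprob.trans ?_
  have h3 : (1 / 3 : ℝ) ≤ Real.exp (-1) := by
    rw [Real.exp_neg, one_div]
    exact inv_anti₀ (Real.exp_pos 1) (by linarith [Real.exp_one_lt_d9])
  calc (1 / 3 : ℝ) ^ K ≤ Real.exp (-1) ^ K := pow_le_pow_left₀ (by norm_num) h3 K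
    _ = Real.exp (-K) := by rw [← Real.exp_nat_mul]; congr 1; ring
    _ ≤ _ := by
      apply Real.exp_le_exp.2
      rw [neg_div, neg_le_neg_iff, div_le_iff₀ (by positivity)]
      nlinarith
end

section
/- For every ε > 0 there is a constant c_ε > 0 such that for every n ≥ 1 and every nontrivial word w ∈ F_r of length l, the Kantorovich-Rubinstein distance (with respect to the normalized Hamming metric) between the distribution of word values of w on S_n and the uniform distribution on S_n is at most c_ε · l² · n^{-1/3+ε}. -/
open Equiv Finset

/-- The normalized Hamming distance on `Perm (Fin n)`. -/
noncomputable def hamming {n : ℕ} (σ τ : Equiv.Perm (Fin n)) : ℝ :=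
  ((Finset.univ.filter fun i => σ i ≠ τ i).card : ℝ) / n

/-- `γ` is a coupling of the probability mass functions `μ` and `ν` on `S_n`. -/
def IsCoupling {n : ℕ} (γ : Equiv.Perm (Fin n) × Equiv.Perm (Fin n) → ℝ)
    (μ ν : Equiv.Perm (Fin n) → ℝ) : Prop :=
  (∀ p, 0 ≤ γ p) ∧ (∀ σ, ∑ τ, γ (σ, τ) = μ σ) ∧ (∀ τ, ∑ σ, γ (σ, τ) = ν τ)

/-- The Kantorovich-Rubinstein distance between probability mass functions on
`S_n`, with respect to the normalized Hamming metric. -/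
noncomputable def KR {n : ℕ} (μ ν : Equiv.Perm (Fin n) → ℝ) : ℝ :=
  sInf {c | ∃ γ, IsCoupling γ μ ν ∧ c = ∑ p, γ p * hamming p.1 p.2}

/-- The uniform probability mass function on a subset `A` of `S_n`. -/
noncomputable def unifOn {n : ℕ} (A : Set (Equiv.Perm (Fin n))) :
    Equiv.Perm (Fin n) → ℝ :=
  A.indicator fun _ => ((A.ncard : ℝ))⁻¹

/-- The number of cycles of a permutation, counting fixed points as cycles. -/
noncomputable def cycleCount {n : ℕ} (σ : Equiv.Perm (Fin n)) : ℕ :=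
  σ.cycleType.card + (Finset.univ.filter fun i => σ i = i).card

/-- The distribution of word values of `w ∈ F_r` on `S_n`: the pushforward of
the uniform measure on `S_n^r` under the word map. -/
noncomputable def wordMeasure {n r : ℕ} (w : FreeGroup (Fin r)) :
    Equiv.Perm (Fin n) → ℝ :=
  fun ρ => ({σ : Fin r → Equiv.Perm (Fin n) | FreeGroup.lift σ w = ρ}.ncard : ℝ) /
    ((n.factorial : ℝ) ^ r)


/-! ### Trajectories of a point along a word -/

/-- The permutation attached to a letter. -/
def wstep {n r : ℕ} (σ : Fin r → Equiv.Perm (Fin n)) (s : Fin r × Bool) : Equiv.Perm (Fin n) :=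
  cond s.2 (σ s.1) (σ s.1)⁻¹

/-- The value at `x` of the word. -/
def wev {n r : ℕ} (σ : Fin r → Equiv.Perm (Fin n)) (x : Fin n) : List (Fin r × Bool) → Fin n
  | [] => x
  | s :: T => wstep σ s (wev σ x T)

/-- The trajectory of `x` along the word (last point first). -/
def wpath {n r : ℕ} (σ : Fin r → Equiv.Perm (Fin n)) (x : Fin n) :
    List (Fin r × Bool) → List (Fin n)
  | [] => [x]
  | s :: T => wev σ x (s :: T) :: wpath σ x T

lemma wev_eq_lift {n r : ℕ} (σ : Fin r → Equiv.Perm (Fin n)) (x : Fin n)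
    (L : List (Fin r × Bool)) : FreeGroup.lift σ (FreeGroup.mk L) x = wev σ x L := by
  rw [FreeGroup.lift_mk]
  induction L with
  | nil => rfl
  | cons s T ih =>
    simp only [List.map_cons, List.prod_cons, Equiv.Perm.mul_apply, ih]
    rfl

lemma wpath_length {n r : ℕ} (σ : Fin r → Equiv.Perm (Fin n)) (x : Fin n)
    (L : List (Fin r × Bool)) : (wpath σ x L).length = L.length + 1 := by
  induction L with
  | nil => rfl
  | cons s T ih => simp [wpath, ih]

lemma wev_mem_wpath {n r : ℕ} (σ : Fin r → Equiv.Perm (Fin n)) (x : Fin n)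
    (U T : List (Fin r × Bool)) (h : U <:+ T) : wev σ x U ∈ wpath σ x T := by
  induction T with
  | nil =>
    rw [List.suffix_nil] at h
    subst h
    simp [wpath, wev]
  | cons t T ih =>
    rcases List.suffix_cons_iff.1 h with h | h
    · subst h
      simp [wpath]
    · exact List.mem_cons_of_mem _ (ih h)

/-- Proper suffixes have different values when the path is simple. -/
lemma wev_eq_imp {n r : ℕ} (σ : Fin r → Equiv.Perm (Fin n)) (x : Fin n)
    (U T : List (Fin r × Bool)) (h : U <:+ T) (hn : (wpath σ x T).Nodup)
    (he : wev σ x U = wev σ x T) : U = T := by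
  cases T with
  | nil => exact List.suffix_nil.1 h
  | cons t T =>
    rcases List.suffix_cons_iff.1 h with h | h
    · exact h
    · have := wev_mem_wpath σ x U T h
      simp only [wpath, List.nodup_cons] at hn
      rw [he] at this
      exact absurd this hn.1

/-- Modify `σ` so that the letter `s` is followed by the transposition `(p y)`. -/
def wmod {n r : ℕ} (σ : Fin r → Equiv.Perm (Fin n)) (s : Fin r × Bool) (p y : Fin n) :
    Fin r → Equiv.Perm (Fin n) :=
  Function.update σ s.1 (cond s.2 (Equiv.swap p y * σ s.1) (σ s.1 * Equiv.swap p y))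

lemma wstep_wmod_self {n r : ℕ} (σ : Fin r → Equiv.Perm (Fin n)) (s : Fin r × Bool)
    (p y : Fin n) : wstep (wmod σ s p y) s = Equiv.swap p y * wstep σ s := by
  rcases s with ⟨a, b⟩
  cases b <;> simp [wstep, wmod]

lemma wstep_wmod_inv {n r : ℕ} (σ : Fin r → Equiv.Perm (Fin n)) (s : Fin r × Bool)
    (p y : Fin n) :
    wstep (wmod σ s p y) (s.1, !s.2) = wstep σ (s.1, !s.2) * Equiv.swap p y := by
  rcases s with ⟨a, b⟩
  cases b <;> simp [wstep, wmod]

lemma wstep_inv {n r : ℕ} (σ : Fin r → Equiv.Perm (Fin n)) (s : Fin r × Bool) :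
    wstep σ (s.1, !s.2) = (wstep σ s)⁻¹ := by
  rcases s with ⟨a, b⟩
  cases b <;> simp [wstep]

lemma wstep_wmod_ne {n r : ℕ} (σ : Fin r → Equiv.Perm (Fin n)) (s t : Fin r × Bool)
    (p y : Fin n) (h : t.1 ≠ s.1) : wstep (wmod σ s p y) t = wstep σ t := by
  simp [wstep, wmod, h]

lemma wmod_wmod {n r : ℕ} (σ : Fin r → Equiv.Perm (Fin n)) (s : Fin r × Bool) (p y : Fin n) :
    wmod (wmod σ s p y) s p y = σ := by
  rcases s with ⟨a, b⟩
  cases b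
  · simp [wmod, mul_assoc]
  · simp [wmod, ← mul_assoc]

lemma wpath_wmod {n r : ℕ} (σ : Fin r → Equiv.Perm (Fin n)) (x : Fin n) (s : Fin r × Bool)
    (T : List (Fin r × Bool)) (hr : FreeGroup.IsReduced (s :: T)) (hn : (wpath σ x T).Nodup)
    (y : Fin n) (hy : y ∉ wpath σ x T) (U : List (Fin r × Bool)) (hU : U <:+ T) :
    wev (wmod σ s (wev σ x (s :: T)) y) x U = wev σ x U ∧
    wpath (wmod σ s (wev σ x (s :: T)) y) x U = wpath σ x U := by
  set p := wev σ x (s :: T) with hp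
  induction U with
  | nil => exact ⟨rfl, rfl⟩
  | cons t U ih =>
    have hUT : U <:+ T := (List.suffix_cons t U).trans hU
    obtain ⟨ih1, ih2⟩ := ih hUT
    have key : wev (wmod σ s p y) x (t :: U) = wev σ x (t :: U) := by
      have hmem : wev σ x (t :: U) ∈ wpath σ x T := wev_mem_wpath σ x _ T hU
      have hmem' : wev σ x U ∈ wpath σ x T := wev_mem_wpath σ x _ T hUT
      simp only [wev, ih1]
      by_cases h1 : t.1 = s.1
      · by_cases h2 : t.2 = s.2
        · have : t = s := Prod.ext h1 h2
          subst this
          rw [wstep_wmod_self, Equiv.Perm.mul_apply]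
          apply Equiv.swap_apply_of_ne_of_ne
          · intro h
            rw [hp] at h
            simp only [wev] at h
            have h' := wev_eq_imp σ x U T hUT hn ((wstep σ t).injective h)
            subst h'
            have := hU.length_le
            simp at this
          · intro h
            simp only [wev] at hmem
            rw [h] at hmem
            exact hy hmem
        · have : t = (s.1, !s.2) := Prod.ext h1 (by cases ht : t.2 <;> cases hs : s.2 <;> simp_all)
          rw [this, wstep_wmod_inv, Equiv.Perm.mul_apply, Equiv.swap_apply_of_ne_of_ne]
          · intro h
            have h3 : wev σ x (t :: U) = wev σ x T := by
              rw [this]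
              simp only [wev]
              rw [h, hp, wstep_inv]
              simp [wev]
            have h4 := wev_eq_imp σ x _ T hU hn h3
            rw [← h4, FreeGroup.isReduced_cons_cons] at hr
            exact h2 (hr.1 h1.symm).symm
          · intro h
            exact hy (h ▸ hmem')
      · rw [wstep_wmod_ne _ _ _ _ _ h1]
    refine ⟨key, ?_⟩
    simp only [wpath, ih2, key]

lemma card_bad_step {n r : ℕ} (x : Fin n) (s : Fin r × Bool)
    (T : List (Fin r × Bool)) (hr : FreeGroup.IsReduced (s :: T)) :
    (univ.filter fun σ : Fin r → Equiv.Perm (Fin n) =>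
      (wpath σ x T).Nodup ∧ wev σ x (s :: T) ∈ wpath σ x T).card * (n - (T.length + 1)) ≤
      (T.length + 1) * Fintype.card (Fin r → Equiv.Perm (Fin n)) := by
  classical
  set B := univ.filter fun σ : Fin r → Equiv.Perm (Fin n) =>
      (wpath σ x T).Nodup ∧ wev σ x (s :: T) ∈ wpath σ x T with hB
  let D : Finset (Σ _ : Fin r → Equiv.Perm (Fin n), Fin n) :=
    B.sigma fun σ => univ \ (wpath σ x T).toFinset
  let C : Finset (Σ _ : Fin r → Equiv.Perm (Fin n), Fin n) :=
    univ.sigma fun σ => (wpath σ x T).toFinset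
  have hD : B.card * (n - (T.length + 1)) ≤ D.card := by
    rw [Finset.card_sigma]
    rw [← smul_eq_mul]
    apply Finset.card_nsmul_le_sum
    intro σ _
    have h1 := List.toFinset_card_le (wpath σ x T)
    rw [wpath_length] at h1
    rw [Finset.card_sdiff_of_subset (Finset.subset_univ _), Finset.card_univ, Fintype.card_fin]
    omega
  have hC : C.card ≤ (T.length + 1) * Fintype.card (Fin r → Equiv.Perm (Fin n)) := by
    rw [Finset.card_sigma, mul_comm, ← smul_eq_mul, ← Finset.card_univ]
    apply Finset.sum_le_card_nsmul
    intro σ _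
    have h1 := List.toFinset_card_le (wpath σ x T)
    rwa [wpath_length] at h1
  refine hD.trans (le_trans ?_ hC)
  refine Finset.card_le_card_of_injOn
    (fun q => ⟨wmod q.1 s (wev q.1 x (s :: T)) q.2, wev q.1 x (s :: T)⟩) ?_ ?_
  · rintro ⟨σ, y⟩ h
    simp only [D, hB, Finset.coe_sigma, Set.mem_sigma_iff, Finset.mem_coe, Finset.mem_filter,
      Finset.mem_univ, true_and, Finset.mem_sdiff, List.mem_toFinset] at h
    simp only [C, Finset.coe_sigma, Set.mem_sigma_iff, Finset.mem_coe,
      Finset.mem_univ, true_and, List.mem_toFinset]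
    rw [(wpath_wmod σ x s T hr h.1.1 y h.2 T List.suffix_rfl).2]
    exact h.1.2
  · rintro ⟨σ, y⟩ h ⟨σ', y'⟩ h' he
    simp only [D, hB, Finset.coe_sigma, Set.mem_sigma_iff, Finset.mem_coe, Finset.mem_filter,
      Finset.mem_univ, true_and, Finset.mem_sdiff, List.mem_toFinset] at h h'
    simp only [Sigma.mk.injEq, heq_eq_eq] at he
    obtain ⟨he1, he2⟩ := he
    have e1 : wev (wmod σ s (wev σ x (s :: T)) y) x (s :: T) = y := by
      have := (wpath_wmod σ x s T hr h.1.1 y h.2 T List.suffix_rfl).1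
      rw [wev, this, wstep_wmod_self, Equiv.Perm.mul_apply]
      exact Equiv.swap_apply_left _ _
    have e2 : wev (wmod σ' s (wev σ' x (s :: T)) y') x (s :: T) = y' := by
      have := (wpath_wmod σ' x s T hr h'.1.1 y' h'.2 T List.suffix_rfl).1
      rw [wev, this, wstep_wmod_self, Equiv.Perm.mul_apply]
      exact Equiv.swap_apply_left _ _
    have e3 : y = y' := by rw [← e1, ← e2, he1]
    subst e3
    have e4 : σ = σ' := by
      rw [← wmod_wmod σ s (wev σ x (s :: T)) y, he1, he2, wmod_wmod]
    subst e4
    rfl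

lemma card_not_nodup {n r : ℕ} (x : Fin n)
    (T : List (Fin r × Bool)) (hr : FreeGroup.IsReduced T) :
    (univ.filter fun σ : Fin r → Equiv.Perm (Fin n) =>
      ¬ (wpath σ x T).Nodup).card * (n - T.length) ≤
      T.length ^ 2 * Fintype.card (Fin r → Equiv.Perm (Fin n)) := by
  classical
  induction T with
  | nil => simp [wpath]
  | cons s T ih =>
    have ih := ih (hr.infix (List.suffix_cons s T).isInfix)
    have hb := card_bad_step (n := n) x s T hr
    have hsub : (univ.filter fun σ : Fin r → Equiv.Perm (Fin n) =>
        ¬ (wpath σ x (s :: T)).Nodup) ⊆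
        (univ.filter fun σ : Fin r → Equiv.Perm (Fin n) => ¬ (wpath σ x T).Nodup) ∪
        (univ.filter fun σ : Fin r → Equiv.Perm (Fin n) =>
          (wpath σ x T).Nodup ∧ wev σ x (s :: T) ∈ wpath σ x T) := by
      intro σ
      simp only [wpath, List.nodup_cons, Finset.mem_filter, Finset.mem_univ, true_and,
        Finset.mem_union]
      tauto
    have hc := (Finset.card_le_card hsub).trans (Finset.card_union_le _ _)
    have hlen : (s :: T).length = T.length + 1 := rfl
    rw [hlen]
    refine (Nat.mul_le_mul_right _ hc).trans ?_
    rw [add_mul]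
    have h1 : (univ.filter fun σ : Fin r → Equiv.Perm (Fin n) =>
      ¬ (wpath σ x T).Nodup).card * (n - (T.length + 1)) ≤ _ :=
      (Nat.mul_le_mul_left _ (by omega : n - (T.length + 1) ≤ n - T.length)).trans ih
    refine (add_le_add h1 hb).trans ?_
    rw [← add_mul]
    exact Nat.mul_le_mul_right _ (by nlinarith)

/-- The expected number of fixed points of a nontrivial word of length `l` is at most `2 l²`. -/
lemma sum_fix_le {n r : ℕ} (w : FreeGroup (Fin r)) (hw : w ≠ 1) :
    ∑ σ : Fin r → Equiv.Perm (Fin n),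
      ((univ.filter fun x => FreeGroup.lift σ w x = x).card : ℝ) ≤
      2 * (w.toWord.length : ℝ) ^ 2 * (n.factorial : ℝ) ^ r := by
  classical
  set N := Fintype.card (Fin r → Equiv.Perm (Fin n)) with hN
  have hNv : (N : ℝ) = (n.factorial : ℝ) ^ r := by
    rw [hN, Fintype.card_fun, Fintype.card_perm, Fintype.card_fin, Fintype.card_fin]
    push_cast
    rfl
  set l := w.toWord.length with hl
  have hl1 : 1 ≤ l := by
    rw [Nat.one_le_iff_ne_zero, hl, Ne, List.length_eq_zero_iff, FreeGroup.toWord_eq_nil_iff]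
    exact hw
  have hl1' : (1 : ℝ) ≤ l := by exact_mod_cast hl1
  rw [← hNv]
  by_cases hln : n < 2 * l
  · have : ∀ σ ∈ (univ : Finset (Fin r → Equiv.Perm (Fin n))),
        ((univ.filter fun x => FreeGroup.lift σ w x = x).card : ℝ) ≤ n := by
      intro σ _
      have := Finset.card_filter_le (univ : Finset (Fin n)) (fun x => FreeGroup.lift σ w x = x)
      rw [Finset.card_univ, Fintype.card_fin] at this
      exact_mod_cast this
    refine (Finset.sum_le_card_nsmul _ _ _ this).trans ?_
    rw [nsmul_eq_mul, Finset.card_univ, ← hN, mul_comm]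
    have h2 : (n : ℝ) ≤ 2 * l := by exact_mod_cast hln.le
    have : (n : ℝ) ≤ 2 * (l : ℝ) ^ 2 := by nlinarith
    gcongr
  · push Not at hln
    have hx : ∀ x : Fin n, ((univ.filter fun σ : Fin r → Equiv.Perm (Fin n) =>
        FreeGroup.lift σ w x = x).card : ℝ) * n ≤ 2 * (l : ℝ) ^ 2 * N := by
      intro x
      have h1 := card_not_nodup (n := n) x w.toWord FreeGroup.isReduced_toWord
      have h2 : (univ.filter fun σ : Fin r → Equiv.Perm (Fin n) =>
          FreeGroup.lift σ w x = x) ⊆ (univ.filter fun σ : Fin r → Equiv.Perm (Fin n) =>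
          ¬ (wpath σ x w.toWord).Nodup) := by
        intro σ
        simp only [Finset.mem_filter, Finset.mem_univ, true_and]
        intro h hn
        have h3 : wev σ x [] = wev σ x w.toWord := by
          rw [← wev_eq_lift, ← wev_eq_lift, FreeGroup.mk_toWord, h]
          simp [FreeGroup.lift_mk]
        have := wev_eq_imp σ x [] w.toWord List.nil_suffix hn h3
        exact hw (FreeGroup.toWord_eq_nil_iff.1 this.symm)
      have h3 := Finset.card_le_card h2
      have h4 := (Nat.mul_le_mul_right (n - l) h3).trans h1
      have h5 : n ≤ 2 * (n - l) := by omega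
      have h6 : (univ.filter fun σ : Fin r → Equiv.Perm (Fin n) =>
          FreeGroup.lift σ w x = x).card * n ≤ 2 * l ^ 2 * N := by
        refine (Nat.mul_le_mul_left _ h5).trans ?_
        rw [mul_left_comm, mul_assoc]
        exact Nat.mul_le_mul_left _ h4
      exact_mod_cast h6
    have hswap : ∑ σ : Fin r → Equiv.Perm (Fin n),
        ((univ.filter fun x => FreeGroup.lift σ w x = x).card : ℝ) =
        ∑ x : Fin n, ((univ.filter fun σ : Fin r → Equiv.Perm (Fin n) =>
        FreeGroup.lift σ w x = x).card : ℝ) := by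
      simp only [Finset.card_filter, Nat.cast_sum]
      rw [Finset.sum_comm]
    rw [hswap]
    have hn0 : (0 : ℝ) < n := by
      have : 0 < n := by omega
      exact_mod_cast this
    refine le_of_mul_le_mul_right ?_ hn0
    rw [Finset.sum_mul]
    refine (Finset.sum_le_card_nsmul _ _ _ (fun x _ => hx x)).trans ?_
    rw [nsmul_eq_mul, Finset.card_univ, Fintype.card_fin, mul_comm]


/-! ### Merging all the cycles of a permutation into one -/

lemma perm_mem_periodicPts {n : ℕ} (τ : Equiv.Perm (Fin n)) (x : Fin n) :
    x ∈ Function.periodicPts τ := by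
  refine Function.mk_mem_periodicPts (orderOf_pos τ) ?_
  rw [Function.IsPeriodicPt, Function.IsFixedPt, Equiv.Perm.iterate_eq_pow, pow_orderOf_eq_one]
  rfl

lemma exists_list_aux {n : ℕ} (τ : Equiv.Perm (Fin n)) (m : ℕ) :
    ∀ S : Finset (Fin n), S.card ≤ m → (∀ a, τ a ∈ S ↔ a ∈ S) →
    ∃ l : List (Fin n), l.Nodup ∧ l.toFinset = S ∧
      (((S.filter fun a => ¬ [a, τ a] <:+: l).card : ℕ) : ℝ) ≤
        ∑ x ∈ S, ((Function.minimalPeriod τ x : ℝ))⁻¹ := by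
  induction m with
  | zero =>
    intro S hS _
    have : S = ∅ := by simpa using hS
    subst this
    exact ⟨[], by simp⟩
  | succ m ih =>
    intro S hS hinv
    rcases S.eq_empty_or_nonempty with rfl | ⟨x, hx⟩
    · exact ⟨[], by simp⟩
    set p := Function.minimalPeriod τ x with hp
    have hp0 : 0 < p := Function.minimalPeriod_pos_of_mem_periodicPts (perm_mem_periodicPts τ x)
    set l₁ := List.iterate τ x p with hl₁
    have hnod : l₁.Nodup := by
      rw [List.nodup_iff_injective_get]
      intro i j hij
      simp only [List.get_eq_getElem, hl₁, List.getElem_iterate] at hij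
      have hi := i.2
      have hj := j.2
      simp only [hl₁, List.length_iterate] at hi hj
      apply Fin.ext
      exact Function.iterate_injOn_Iio_minimalPeriod hi hj hij
    set O := l₁.toFinset with hO
    have hOc : O.card = p := by
      rw [hO, List.toFinset_card_of_nodup hnod, hl₁, List.length_iterate]
    have hmemO : ∀ a, a ∈ O ↔ ∃ k < p, a = τ^[k] x := by
      intro a
      rw [hO, List.mem_toFinset, hl₁, List.mem_iterate]
    have hper : τ^[p] x = x := Function.isPeriodicPt_minimalPeriod τ x
    have hmemO' : ∀ k, τ^[k] x ∈ O := by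
      intro k
      rw [hmemO]
      exact ⟨k % p, Nat.mod_lt _ hp0, (Function.iterate_mod_minimalPeriod_eq (f := τ) (x := x)).symm⟩
    have hOinv : ∀ a, τ a ∈ O ↔ a ∈ O := by
      intro a
      constructor
      · intro h
        obtain ⟨k, hk, h⟩ := (hmemO _).1 h
        have : a = τ^[k + (p - 1)] x := by
          apply τ.injective
          rw [h, ← Function.iterate_succ_apply' τ,
            show (k + (p - 1)).succ = k + p by omega, Function.iterate_add_apply, hper]
        rw [this]
        exact hmemO' _
      · intro h
        obtain ⟨k, hk, rfl⟩ := (hmemO _).1 h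
        rw [← Function.iterate_succ_apply' τ]
        exact hmemO' _
    have hOS : O ⊆ S := by
      intro a h
      obtain ⟨k, hk, rfl⟩ := (hmemO _).1 h
      clear hk h
      induction k with
      | zero => exact hx
      | succ k ihk => rw [Function.iterate_succ_apply', hinv]; exact ihk
    obtain ⟨l₂, hl2n, hl2S, hl2⟩ := ih (S \ O)
      (by rw [Finset.card_sdiff_of_subset hOS]; omega)
      (by intro a; simp only [Finset.mem_sdiff, hinv, hOinv])
    refine ⟨l₁ ++ l₂, ?_, ?_, ?_⟩
    · rw [List.nodup_append']
      refine ⟨hnod, hl2n, ?_⟩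
      intro a h1 h2
      rw [← List.mem_toFinset] at h1 h2
      rw [hl2S] at h2
      exact (Finset.mem_sdiff.1 h2).2 h1
    · rw [List.toFinset_append, hl2S, ← hO]
      exact Finset.union_sdiff_of_subset hOS
    · have hsub : (S.filter fun a => ¬ [a, τ a] <:+: l₁ ++ l₂) ⊆
          insert (τ^[p - 1] x) ((S \ O).filter fun a => ¬ [a, τ a] <:+: l₂) := by
        intro a ha
        simp only [Finset.mem_filter, Finset.mem_insert, Finset.mem_sdiff] at ha ⊢
        obtain ⟨haS, ha⟩ := ha
        by_cases haO : a ∈ O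
        · left
          obtain ⟨k, hk, rfl⟩ := (hmemO _).1 haO
          by_contra hne
          have hk' : k ≠ p - 1 := fun h => hne (by rw [h])
          apply ha
          refine List.IsInfix.trans ?_ (List.prefix_append l₁ l₂).isInfix
          have : p = k + (2 + (p - k - 2)) := by omega
          rw [hl₁, this, List.iterate_add, List.iterate_add]
          refine ⟨List.iterate τ x k, List.iterate τ (τ^[2] (τ^[k] x)) (p - k - 2), ?_⟩
          simp [List.iterate]
        · right
          refine ⟨⟨haS, haO⟩, fun h => ha (h.trans (List.suffix_append l₁ l₂).isInfix)⟩
      have hc := (Finset.card_le_card hsub).trans (Finset.card_insert_le _ _)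
      have hsum : ∑ a ∈ O, ((Function.minimalPeriod τ a : ℝ))⁻¹ = 1 := by
        have : ∀ a ∈ O, ((Function.minimalPeriod τ a : ℝ))⁻¹ = (p : ℝ)⁻¹ := by
          intro a h
          obtain ⟨k, hk, rfl⟩ := (hmemO _).1 h
          rw [Function.minimalPeriod_apply_iterate (perm_mem_periodicPts τ x)]
        rw [Finset.sum_congr rfl this, Finset.sum_const, hOc, nsmul_eq_mul]
        apply mul_inv_cancel₀
        exact_mod_cast hp0.ne'
      rw [← Finset.sum_sdiff hOS, hsum]
      have hc' : (((S.filter fun a => ¬ [a, τ a] <:+: l₁ ++ l₂).card : ℕ) : ℝ) ≤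
          (((S \ O).filter fun a => ¬ [a, τ a] <:+: l₂).card : ℕ) + 1 := by exact_mod_cast hc
      linarith

/-- Every permutation has a conjugate which differs from the standard `n`-cycle at no more
places than it has cycles. -/
lemma exists_conj_near {n : ℕ} (τ : Equiv.Perm (Fin n)) :
    ∃ k : Equiv.Perm (Fin n),
      ((univ.filter fun i => (k * τ * k⁻¹) i ≠ finRotate n i).card : ℝ) ≤
        ∑ x, ((Function.minimalPeriod τ x : ℝ))⁻¹ := by
  obtain ⟨l, hn, hS, hb⟩ := exists_list_aux τ n univ (by simp) (by simp)
  have hlen : l.length = n := by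
    rw [← List.toFinset_card_of_nodup hn, hS, Finset.card_univ, Fintype.card_fin]
  let f : Fin n → Fin n := fun i => l.get (i.cast hlen.symm)
  have hf : Function.Injective f := by
    intro i j h
    have := List.nodup_iff_injective_get.1 hn h
    simpa using this
  let e : Equiv.Perm (Fin n) := Equiv.ofBijective f (Finite.injective_iff_bijective.1 hf)
  refine ⟨e⁻¹, le_trans ?_ hb⟩
  rw [Nat.cast_le]
  refine Finset.card_le_card_of_injOn e ?_ (e.injective.injOn)
  intro i hi
  simp only [Finset.coe_filter, Finset.mem_univ, true_and, Set.mem_ofPred_eq] at hi ⊢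
  rintro ⟨A, B, h⟩
  apply hi
  simp only [inv_inv, Equiv.Perm.mul_apply]
  rw [Equiv.Perm.inv_eq_iff_eq]
  have hl' : l = A ++ e i :: τ (e i) :: B := by rw [← h]; simp
  have hA : A.length + 1 < n := by
    have := congrArg List.length hl'
    simp only [List.length_append, List.length_cons] at this
    omega
  have hiA : i = ⟨A.length, by omega⟩ := by
    apply hf
    have : f ⟨A.length, by omega⟩ = e i := by
      simp only [f, List.get_eq_getElem, Fin.val_cast]
      simp [hl']
    rw [this]; rfl
  obtain ⟨n, rfl⟩ : ∃ m, n = m + 1 := ⟨n - 1, by omega⟩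
  conv_rhs => rw [hiA]
  rw [finRotate_of_lt (by omega)]
  have : f ⟨A.length + 1, by omega⟩ = τ (e i) := by
    simp only [f, List.get_eq_getElem, Fin.val_cast]
    simp [hl']
  exact this.symm

lemma inv_period_le {n : ℕ} (τ : Equiv.Perm (Fin n)) (x : Fin n) (k : ℕ) (hk : 0 < k) :
    ((Function.minimalPeriod τ x : ℝ))⁻¹ ≤ (k : ℝ)⁻¹ +
      ∑ j ∈ Finset.Icc 1 k, (j : ℝ)⁻¹ * (if (τ ^ j) x = x then 1 else 0) := by
  set p := Function.minimalPeriod τ x with hp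
  have hp0 : 0 < p := Function.minimalPeriod_pos_of_mem_periodicPts (perm_mem_periodicPts τ x)
  have hk' : (0 : ℝ) < k := by exact_mod_cast hk
  have hnn : ∀ j ∈ Finset.Icc 1 k,
      (0 : ℝ) ≤ (j : ℝ)⁻¹ * (if (τ ^ j) x = x then 1 else 0) := by
    intro j _
    positivity
  rcases le_or_gt p k with h | h
  · have hper : (τ ^ p) x = x := by
      rw [← Equiv.Perm.iterate_eq_pow]
      exact Function.isPeriodicPt_minimalPeriod τ x
    have := Finset.single_le_sum hnn (Finset.mem_Icc.2 ⟨hp0, h⟩)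
    rw [if_pos hper, mul_one] at this
    have h2 : (0 : ℝ) ≤ (k : ℝ)⁻¹ := by positivity
    linarith
  · have h1 : (p : ℝ)⁻¹ ≤ (k : ℝ)⁻¹ := by
      apply inv_anti₀ hk'
      exact_mod_cast h.le
    have := Finset.sum_nonneg hnn
    linarith

/-! ### Coupling conjugation invariant measures -/

lemma hamming_nonneg {n : ℕ} (σ τ : Equiv.Perm (Fin n)) : 0 ≤ hamming σ τ := by
  unfold hamming
  positivity

lemma hamming_conj {n : ℕ} (g σ τ : Equiv.Perm (Fin n)) :
    hamming (g * σ * g⁻¹) (g * τ * g⁻¹) = hamming σ τ := by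
  unfold hamming
  congr 2
  refine Finset.card_bij (fun i _ => g⁻¹ i) ?_ ?_ ?_
  · intro i hi
    simpa using hi
  · intro i _ j _ h
    exact g⁻¹.injective h
  · intro j hj
    refine ⟨g j, ?_, by simp⟩
    simpa using hj

lemma hamming_triangle {n : ℕ} (σ τ ρ : Equiv.Perm (Fin n)) :
    hamming σ τ ≤ hamming σ ρ + hamming τ ρ := by
  unfold hamming
  rw [← add_div]
  gcongr
  have : (univ.filter fun i => σ i ≠ τ i) ⊆
      (univ.filter fun i => σ i ≠ ρ i) ∪ (univ.filter fun i => τ i ≠ ρ i) := by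
    intro i
    simp only [Finset.mem_filter, Finset.mem_univ, true_and, Finset.mem_union]
    intro h
    by_contra! h'
    exact h (h'.1.trans h'.2.symm)
  exact_mod_cast (Finset.card_le_card this).trans (Finset.card_union_le _ _)

/-- Averaging over conjugates reproduces a conjugation invariant function. -/
lemma avg_conj {n : ℕ} (μ : Equiv.Perm (Fin n) → ℝ)
    (hμ : ∀ g σ, μ (g * σ * g⁻¹) = μ σ) (k : Equiv.Perm (Fin n) → Equiv.Perm (Fin n))
    (σ : Equiv.Perm (Fin n)) :
    ∑ τ, ∑ g : Equiv.Perm (Fin n),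
      (if (g * k τ) * τ * (g * k τ)⁻¹ = σ then μ τ else 0) = n.factorial * μ σ := by
  have h1 : ∀ τ : Equiv.Perm (Fin n), ∑ g : Equiv.Perm (Fin n),
      (if (g * k τ) * τ * (g * k τ)⁻¹ = σ then μ τ else 0) =
      ∑ g : Equiv.Perm (Fin n), (if τ = g⁻¹ * σ * g then μ τ else 0) := by
    intro τ
    refine (Fintype.sum_equiv (Equiv.mulRight (k τ)) _
      (fun g => if g * τ * g⁻¹ = σ then μ τ else 0) (fun g => rfl)).trans ?_
    refine Finset.sum_congr rfl fun g _ => ?_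
    have : g * τ * g⁻¹ = σ ↔ τ = g⁻¹ * σ * g := by
      constructor
      · rintro rfl
        group
      · rintro rfl
        group
    simp only [this]
  rw [Finset.sum_congr rfl (fun τ _ => h1 τ), Finset.sum_comm]
  have h2 : ∀ g ∈ (univ : Finset (Equiv.Perm (Fin n))),
      ∑ τ, (if τ = g⁻¹ * σ * g then μ τ else 0) = μ σ := by
    intro g _
    rw [Finset.sum_ite_eq' univ (g⁻¹ * σ * g) μ, if_pos (Finset.mem_univ _)]
    have := hμ g⁻¹ σ
    rwa [inv_inv] at this
  rw [Finset.sum_congr rfl h2, Finset.sum_const, Finset.card_univ, Fintype.card_perm,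
    Fintype.card_fin, nsmul_eq_mul]

lemma marg_left {G : Type*} [Fintype G] [DecidableEq G] (a : G → G → G) (μ ν : G → ℝ)
    (hν1 : ∑ σ, ν σ = 1) (σ : G) :
    ∑ τ, ∑ τ₁, ∑ τ₂, ∑ g, (if a g τ₁ = σ then μ τ₁ else 0) * (if a g τ₂ = τ then ν τ₂ else 0) =
      ∑ τ₁, ∑ g, (if a g τ₁ = σ then μ τ₁ else 0) := by
  rw [Finset.sum_comm]
  refine Finset.sum_congr rfl fun τ₁ _ => ?_
  rw [Finset.sum_comm]
  have e : ∀ τ₂, ∑ τ, ∑ g, (if a g τ₁ = σ then μ τ₁ else 0) *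
      (if a g τ₂ = τ then ν τ₂ else 0) = ∑ g, (if a g τ₁ = σ then μ τ₁ else 0) * ν τ₂ := by
    intro τ₂
    rw [Finset.sum_comm]
    refine Finset.sum_congr rfl fun g _ => ?_
    rw [← Finset.mul_sum, Finset.sum_ite_eq, if_pos (Finset.mem_univ _)]
  rw [Finset.sum_congr rfl fun τ₂ _ => e τ₂, Finset.sum_comm]
  refine Finset.sum_congr rfl fun g _ => ?_
  rw [← Finset.mul_sum, hν1, mul_one]

lemma marg_right {G : Type*} [Fintype G] [DecidableEq G] (a : G → G → G) (μ ν : G → ℝ)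
    (hμ1 : ∑ σ, μ σ = 1) (τ : G) :
    ∑ σ, ∑ τ₁, ∑ τ₂, ∑ g, (if a g τ₁ = σ then μ τ₁ else 0) * (if a g τ₂ = τ then ν τ₂ else 0) =
      ∑ τ₂, ∑ g, (if a g τ₂ = τ then ν τ₂ else 0) := by
  rw [← marg_left a ν μ hμ1 τ]
  refine Finset.sum_congr rfl fun σ _ => ?_
  rw [Finset.sum_comm]
  refine Finset.sum_congr rfl fun τ₂ _ => Finset.sum_congr rfl fun τ₁ _ =>
    Finset.sum_congr rfl fun g _ => mul_comm _ _

lemma coupling_cost {G : Type*} [Fintype G] [DecidableEq G] (a : G → G → G) (μ ν : G → ℝ)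
    (h : G → G → ℝ) :
    ∑ p : G × G, (∑ τ₁, ∑ τ₂, ∑ g, (if a g τ₁ = p.1 then μ τ₁ else 0) *
      (if a g τ₂ = p.2 then ν τ₂ else 0)) * h p.1 p.2 =
      ∑ τ₁, ∑ τ₂, ∑ g, μ τ₁ * ν τ₂ * h (a g τ₁) (a g τ₂) := by
  simp only [Finset.sum_mul]
  rw [Finset.sum_comm]
  refine Finset.sum_congr rfl fun τ₁ _ => ?_
  rw [Finset.sum_comm]
  refine Finset.sum_congr rfl fun τ₂ _ => ?_
  rw [Finset.sum_comm]
  refine Finset.sum_congr rfl fun g _ => ?_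
  rw [Finset.sum_eq_single (a g τ₁, a g τ₂)]
  · simp
  · rintro ⟨p, q⟩ _ hne
    by_cases h1 : a g τ₁ = p
    · by_cases h2 : a g τ₂ = q
      · exact absurd (by rw [h1, h2]) hne
      · simp [h2]
    · simp [h1]
  · simp

lemma KR_le {n : ℕ} (μ ν : Equiv.Perm (Fin n) → ℝ)
    (hμ0 : ∀ σ, 0 ≤ μ σ) (hν0 : ∀ σ, 0 ≤ ν σ)
    (hμ1 : ∑ σ, μ σ = 1) (hν1 : ∑ σ, ν σ = 1)
    (hμ : ∀ g σ, μ (g * σ * g⁻¹) = μ σ) (hν : ∀ g σ, ν (g * σ * g⁻¹) = ν σ)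
    (c : Equiv.Perm (Fin n)) (k : Equiv.Perm (Fin n) → Equiv.Perm (Fin n))
    (D : Equiv.Perm (Fin n) → ℝ) (hD : ∀ τ, hamming (k τ * τ * (k τ)⁻¹) c ≤ D τ) :
    KR μ ν ≤ ∑ σ, μ σ * D σ + ∑ σ, ν σ * D σ := by
  classical
  set N : ℝ := (n.factorial : ℝ) with hN
  have hN0 : 0 < N := by rw [hN]; exact_mod_cast n.factorial_pos
  have hcard : (Fintype.card (Equiv.Perm (Fin n)) : ℝ) = N := by
    rw [Fintype.card_perm, Fintype.card_fin]
  obtain ⟨a, ha⟩ : ∃ a : Equiv.Perm (Fin n) → Equiv.Perm (Fin n) → Equiv.Perm (Fin n),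
    ∀ g τ, a g τ = (g * k τ) * τ * (g * k τ)⁻¹ := ⟨_, fun _ _ => rfl⟩
  let γ : Equiv.Perm (Fin n) × Equiv.Perm (Fin n) → ℝ := fun p =>
    N⁻¹ * ∑ τ₁, ∑ τ₂, ∑ g, (if a g τ₁ = p.1 then μ τ₁ else 0) * (if a g τ₂ = p.2 then ν τ₂ else 0)
  have hγ0 : ∀ p, 0 ≤ γ p := by
    intro p
    refine mul_nonneg (inv_nonneg.2 hN0.le) (Finset.sum_nonneg fun τ₁ _ =>
      Finset.sum_nonneg fun τ₂ _ => Finset.sum_nonneg fun g _ => mul_nonneg ?_ ?_)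
    · split_ifs
      exacts [hμ0 _, le_rfl]
    · split_ifs
      exacts [hν0 _, le_rfl]
  have hγ1 : ∀ σ, ∑ τ, γ (σ, τ) = μ σ := by
    intro σ
    have h1 := marg_left a μ ν hν1 σ
    have h2 := avg_conj μ hμ k σ
    simp only [γ]
    rw [← Finset.mul_sum, h1]
    simp only [ha]
    rw [h2, ← mul_assoc, inv_mul_cancel₀ hN0.ne', one_mul]
  have hγ2 : ∀ τ, ∑ σ, γ (σ, τ) = ν τ := by
    intro τ
    have h1 := marg_right a μ ν hμ1 τ
    have h2 := avg_conj ν hν k τ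
    simp only [γ]
    rw [← Finset.mul_sum, h1]
    simp only [ha]
    rw [h2, ← mul_assoc, inv_mul_cancel₀ hN0.ne', one_mul]
  have hcost : ∑ p, γ p * hamming p.1 p.2 =
      N⁻¹ * ∑ τ₁, ∑ τ₂, ∑ g, μ τ₁ * ν τ₂ * hamming (a g τ₁) (a g τ₂) := by
    rw [← coupling_cost a μ ν hamming, Finset.mul_sum]
    refine Finset.sum_congr rfl fun p _ => ?_
    simp only [γ]
    rw [mul_assoc]
  have hbound : ∀ τ₁ τ₂ g, μ τ₁ * ν τ₂ * hamming (a g τ₁) (a g τ₂) ≤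
      μ τ₁ * ν τ₂ * (D τ₁ + D τ₂) := by
    intro τ₁ τ₂ g
    refine mul_le_mul_of_nonneg_left ?_ (mul_nonneg (hμ0 _) (hν0 _))
    have e : ∀ τ, a g τ = g * (k τ * τ * (k τ)⁻¹) * g⁻¹ := by
      intro τ
      rw [ha]
      group
    rw [e, e, hamming_conj]
    exact (hamming_triangle _ _ c).trans (add_le_add (hD _) (hD _))
  have hle : ∑ p, γ p * hamming p.1 p.2 ≤ ∑ σ, μ σ * D σ + ∑ σ, ν σ * D σ := by
    rw [hcost]
    calc N⁻¹ * ∑ τ₁, ∑ τ₂, ∑ g, μ τ₁ * ν τ₂ * hamming (a g τ₁) (a g τ₂)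
        ≤ N⁻¹ * ∑ τ₁, ∑ τ₂, ∑ _g : Equiv.Perm (Fin n), μ τ₁ * ν τ₂ * (D τ₁ + D τ₂) := by
          refine mul_le_mul_of_nonneg_left ?_ (inv_nonneg.2 hN0.le)
          exact Finset.sum_le_sum fun τ₁ _ => Finset.sum_le_sum fun τ₂ _ =>
            Finset.sum_le_sum fun g _ => hbound τ₁ τ₂ g
      _ = ∑ τ₁, ∑ τ₂, μ τ₁ * ν τ₂ * (D τ₁ + D τ₂) := by
          simp only [Finset.sum_const, Finset.card_univ, nsmul_eq_mul, hcard, ← Finset.mul_sum]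
          rw [← mul_assoc, inv_mul_cancel₀ hN0.ne', one_mul]
      _ = ∑ τ₁, (μ τ₁ * D τ₁ + μ τ₁ * ∑ τ₂, ν τ₂ * D τ₂) := by
          refine Finset.sum_congr rfl fun τ₁ _ => ?_
          have : ∀ τ₂, μ τ₁ * ν τ₂ * (D τ₁ + D τ₂) =
              μ τ₁ * D τ₁ * ν τ₂ + μ τ₁ * (ν τ₂ * D τ₂) := fun τ₂ => by ring
          simp only [this, Finset.sum_add_distrib, ← Finset.mul_sum, hν1, mul_one]
      _ = _ := by
          rw [Finset.sum_add_distrib, ← Finset.sum_mul, hμ1, one_mul]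
  refine le_trans (csInf_le ?_ ⟨γ, ⟨hγ0, hγ1, hγ2⟩, rfl⟩) hle
  refine ⟨0, ?_⟩
  rintro x ⟨γ', ⟨h0, _, _⟩, rfl⟩
  exact Finset.sum_nonneg fun p _ => mul_nonneg (h0 p) (hamming_nonneg _ _)

/-! ### Word measures -/

lemma wordMeasure_nonneg {n r : ℕ} (w : FreeGroup (Fin r)) (ρ : Equiv.Perm (Fin n)) :
    0 ≤ wordMeasure w ρ := by
  unfold wordMeasure
  positivity

lemma sum_wordMeasure {n r : ℕ} (w : FreeGroup (Fin r)) (f : Equiv.Perm (Fin n) → ℝ) :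
    ∑ ρ, wordMeasure w ρ * f ρ =
      (∑ σ : Fin r → Equiv.Perm (Fin n), f (FreeGroup.lift σ w)) / (n.factorial : ℝ) ^ r := by
  classical
  rw [← Finset.sum_fiberwise univ (fun σ : Fin r → Equiv.Perm (Fin n) => FreeGroup.lift σ w),
    Finset.sum_div]
  refine Finset.sum_congr rfl fun ρ _ => ?_
  have : ∑ σ : Fin r → Equiv.Perm (Fin n) with FreeGroup.lift σ w = ρ, f (FreeGroup.lift σ w) =
      ∑ σ : Fin r → Equiv.Perm (Fin n) with FreeGroup.lift σ w = ρ, f ρ := by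
    refine Finset.sum_congr rfl fun σ hσ => ?_
    rw [(Finset.mem_filter.1 hσ).2]
  rw [this, Finset.sum_const, nsmul_eq_mul]
  unfold wordMeasure
  have h2 : {σ : Fin r → Equiv.Perm (Fin n) | FreeGroup.lift σ w = ρ}.ncard =
      (univ.filter fun σ : Fin r → Equiv.Perm (Fin n) => FreeGroup.lift σ w = ρ).card := by
    rw [← Set.ncard_coe_finset]
    congr 1
    ext σ
    simp
  rw [h2]
  ring

lemma sum_wordMeasure_one {n r : ℕ} (w : FreeGroup (Fin r)) :
    ∑ ρ : Equiv.Perm (Fin n), wordMeasure w ρ = 1 := by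
  have := sum_wordMeasure (n := n) w (fun _ => 1)
  simp only [mul_one, Finset.sum_const, Finset.card_univ, nsmul_eq_mul] at this
  rw [this, Fintype.card_fun, Fintype.card_perm, Fintype.card_fin, Fintype.card_fin]
  push_cast
  apply div_self
  have := n.factorial_pos
  positivity

lemma wordMeasure_conj {n r : ℕ} (w : FreeGroup (Fin r)) (g ρ : Equiv.Perm (Fin n)) :
    wordMeasure w (g * ρ * g⁻¹) = wordMeasure w ρ := by
  unfold wordMeasure
  congr 2
  have hconj : ∀ (h : Equiv.Perm (Fin n)) (σ : Fin r → Equiv.Perm (Fin n)),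
      FreeGroup.lift (fun i => h * σ i * h⁻¹) w = h * FreeGroup.lift σ w * h⁻¹ := by
    intro h σ
    have := FreeGroup.lift_unique (f := fun i => h * σ i * h⁻¹)
      ((MulAut.conj h).toMonoidHom.comp (FreeGroup.lift σ)) (by intro x; simp) (x := w)
    rw [← this]
    simp
  refine Set.ncard_congr (fun σ _ => fun i => g⁻¹ * σ i * g) ?_ ?_ ?_
  · intro σ hσ
    have h1 := hconj g⁻¹ σ
    have hσ' : FreeGroup.lift σ w = g * ρ * g⁻¹ := hσ
    rw [inv_inv, hσ'] at h1
    change FreeGroup.lift (fun i => g⁻¹ * σ i * g) w = ρ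
    rw [h1]
    group
  · intro σ τ _ _ h
    funext i
    have := congrFun h i
    simpa using this
  · intro σ hσ
    have hσ' : FreeGroup.lift σ w = ρ := hσ
    refine ⟨fun i => g * σ i * g⁻¹, ?_, ?_⟩
    · change FreeGroup.lift (fun i => g * σ i * g⁻¹) w = g * ρ * g⁻¹
      rw [hconj, hσ']
    · funext i
      group

lemma wordMeasure_of {n : ℕ} :
    wordMeasure (FreeGroup.of (0 : Fin 1)) =
      (fun _ : Equiv.Perm (Fin n) => 1 / (n.factorial : ℝ)) := by
  funext ρ
  unfold wordMeasure
  have : {σ : Fin 1 → Equiv.Perm (Fin n) | FreeGroup.lift σ (FreeGroup.of 0) = ρ} =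
      {fun _ => ρ} := by
    ext σ
    simp only [FreeGroup.lift_apply_of, Set.mem_ofPred_eq, Set.mem_singleton_iff]
    constructor
    · rintro rfl
      funext i
      rw [Subsingleton.elim i 0]
    · rintro rfl
      rfl
  rw [this]
  simp

lemma toWord_pow_length_le {r : ℕ} (w : FreeGroup (Fin r)) (j : ℕ) :
    (w ^ j).toWord.length ≤ j * w.toWord.length := by
  induction j with
  | zero => simp
  | succ j ih =>
    have := FreeGroup.norm_mul_le (w ^ j) w
    unfold FreeGroup.norm at this
    rw [pow_succ, add_mul, one_mul]
    omega

/-- The expected number of cycles of a word value. -/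
lemma expected_cycles {n r : ℕ} (w : FreeGroup (Fin r)) (hw : w ≠ 1) (k : ℕ) (hk : 0 < k) :
    ∑ ρ : Equiv.Perm (Fin n), wordMeasure w ρ *
      ∑ x, ((Function.minimalPeriod ρ x : ℝ))⁻¹ ≤
      n / k + 2 * (w.toWord.length : ℝ) ^ 2 * (k : ℝ) ^ 2 := by
  set N : ℝ := (n.factorial : ℝ) ^ r with hN
  have hN0 : 0 < N := by
    have := n.factorial_pos
    positivity
  set l : ℝ := (w.toWord.length : ℝ) with hl
  rw [sum_wordMeasure, div_le_iff₀ hN0]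
  have h1 : ∀ ρ : Equiv.Perm (Fin n), ∑ x, ((Function.minimalPeriod ρ x : ℝ))⁻¹ ≤
      n / k + ∑ j ∈ Finset.Icc 1 k, (j : ℝ)⁻¹ *
        ((univ.filter fun x => (ρ ^ j) x = x).card : ℝ) := by
    intro ρ
    refine (Finset.sum_le_sum fun x _ => inv_period_le ρ x k hk).trans ?_
    rw [Finset.sum_add_distrib, Finset.sum_const, Finset.card_univ, Fintype.card_fin,
      nsmul_eq_mul, ← div_eq_mul_inv, Finset.sum_comm]
    refine le_of_eq ?_
    congr 1
    refine Finset.sum_congr rfl fun j _ => ?_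
    rw [← Finset.mul_sum, Finset.card_filter]
    push_cast
    rfl
  refine (Finset.sum_le_sum fun σ _ => h1 (FreeGroup.lift σ w)).trans ?_
  rw [Finset.sum_add_distrib, Finset.sum_const, Finset.card_univ, nsmul_eq_mul, Finset.sum_comm,
    add_mul]
  have hcard : (Fintype.card (Fin r → Equiv.Perm (Fin n)) : ℝ) = N := by
    rw [Fintype.card_fun, Fintype.card_perm, Fintype.card_fin, Fintype.card_fin]
    push_cast
    rfl
  rw [hcard, mul_comm N]
  gcongr
  have h2 : ∀ j ∈ Finset.Icc 1 k, ∑ σ : Fin r → Equiv.Perm (Fin n), (j : ℝ)⁻¹ *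
      ((univ.filter fun x => (FreeGroup.lift σ w ^ j) x = x).card : ℝ) ≤
      2 * l ^ 2 * k * N := by
    intro j hj
    obtain ⟨hj1, hjk⟩ := Finset.mem_Icc.1 hj
    have hj0 : (0 : ℝ) < j := by exact_mod_cast hj1
    have hwj : w ^ j ≠ 1 := by
      intro h
      exact hw ((pow_eq_one_iff_left (by omega)).1 h)
    have h3 := sum_fix_le (n := n) (w ^ j) hwj
    simp only [map_pow] at h3
    rw [← hN] at h3
    have h4 : ((w ^ j).toWord.length : ℝ) ≤ j * l := by
      rw [hl]
      exact_mod_cast toWord_pow_length_le w j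
    rw [← Finset.mul_sum]
    calc (j : ℝ)⁻¹ * _ ≤ (j : ℝ)⁻¹ * (2 * (j * l) ^ 2 * N) := by
          refine mul_le_mul_of_nonneg_left (h3.trans ?_) (by positivity)
          gcongr
      _ = 2 * l ^ 2 * j * N := by field_simp
      _ ≤ 2 * l ^ 2 * k * N := by
          have : (j : ℝ) ≤ k := by exact_mod_cast hjk
          gcongr
  refine (Finset.sum_le_card_nsmul _ _ _ h2).trans (le_of_eq ?_)
  rw [Nat.card_Icc, nsmul_eq_mul, Nat.add_sub_cancel]
  ring

lemma expected_cycles' {n r : ℕ} (hn : 1 ≤ n) (w : FreeGroup (Fin r)) (hw : w ≠ 1) :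
    ∑ ρ : Equiv.Perm (Fin n), wordMeasure w ρ *
      ((∑ x, ((Function.minimalPeriod ρ x : ℝ))⁻¹) / n) ≤
      9 * (w.toWord.length : ℝ) ^ 2 * (n : ℝ) ^ (-(1 / 3 : ℝ)) := by
  have hn' : (1 : ℝ) ≤ n := by exact_mod_cast hn
  have hn0 : (0 : ℝ) < n := by linarith
  set t : ℝ := (n : ℝ) ^ (1 / 3 : ℝ) with ht
  have ht1 : 1 ≤ t := Real.one_le_rpow hn' (by norm_num)
  have ht3 : t ^ 3 = n := by
    rw [ht, ← Real.rpow_natCast, ← Real.rpow_mul hn0.le]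
    norm_num
  have hti : (n : ℝ) ^ (-(1 / 3 : ℝ)) = t⁻¹ := by
    rw [ht, Real.rpow_neg hn0.le]
  have hk0 : 0 < ⌈t⌉₊ := Nat.ceil_pos.2 (by linarith)
  have hkl : t ≤ ⌈t⌉₊ := Nat.le_ceil t
  have hku : (⌈t⌉₊ : ℝ) ≤ 2 * t := by
    have := Nat.ceil_lt_add_one (by linarith : 0 ≤ t)
    linarith
  have h := expected_cycles (n := n) w hw ⌈t⌉₊ hk0
  have hl1 : (1 : ℝ) ≤ w.toWord.length := by
    have : 1 ≤ w.toWord.length := by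
      rw [Nat.one_le_iff_ne_zero, Ne, List.length_eq_zero_iff, FreeGroup.toWord_eq_nil_iff]
      exact hw
    exact_mod_cast this
  set l : ℝ := (w.toWord.length : ℝ) with hl
  simp only [mul_div_assoc']
  rw [← Finset.sum_div, div_le_iff₀ hn0, hti]
  refine h.trans ?_
  have h1 : (n : ℝ) / ⌈t⌉₊ ≤ t ^ 2 := by
    rw [div_le_iff₀ (by linarith), ← ht3]
    nlinarith [sq_nonneg t]
  have h2 : (⌈t⌉₊ : ℝ) ^ 2 ≤ 4 * t ^ 2 := by nlinarith
  have h3 : 9 * l ^ 2 * t⁻¹ * n = 9 * l ^ 2 * t ^ 2 := by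
    rw [← ht3]
    field_simp
  rw [h3]
  have h4 : 1 ≤ l ^ 2 := by nlinarith
  have h5 : 2 * l ^ 2 * (⌈t⌉₊ : ℝ) ^ 2 ≤ 2 * l ^ 2 * (4 * t ^ 2) := by gcongr
  nlinarith [sq_nonneg t]

/-- For every `ε > 0` there is `c_ε > 0` such that for every `n ≥ 1` and every
nontrivial word `w ∈ F_r` of length `l`, the Kantorovich-Rubinstein distance
between the distribution of word values of `w` on `S_n` and the uniform
distribution is at most `c_ε · l² · n^{-1/3+ε}`. -/
theorem stmt19 (ε : ℝ) (hε : 0 < ε) :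
    ∃ c : ℝ, 0 < c ∧ ∀ (n r : ℕ), 1 ≤ n → ∀ w : FreeGroup (Fin r), w ≠ 1 →
      KR (wordMeasure (n := n) w) (fun _ => 1 / (n.factorial : ℝ)) ≤
        c * ((FreeGroup.toWord w).length : ℝ) ^ 2 *
          (n : ℝ) ^ (-(1 / 3 : ℝ) + ε) := by
  refine ⟨18, by norm_num, ?_⟩
  intro n r hn w hw
  have hn' : (1 : ℝ) ≤ n := by exact_mod_cast hn
  have hn0 : (0 : ℝ) < n := by linarith
  choose k hk using fun τ : Equiv.Perm (Fin n) => exists_conj_near τ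
  have hD : ∀ τ : Equiv.Perm (Fin n), hamming (k τ * τ * (k τ)⁻¹) (finRotate n) ≤
      (∑ x, ((Function.minimalPeriod τ x : ℝ))⁻¹) / n := by
    intro τ
    unfold hamming
    exact div_le_div_of_nonneg_right (hk τ) hn0.le
  have hu : FreeGroup.of (0 : Fin 1) ≠ 1 := FreeGroup.of_ne_one _
  have hKR := KR_le (wordMeasure (n := n) w) (wordMeasure (n := n) (FreeGroup.of (0 : Fin 1)))
    (wordMeasure_nonneg w) (wordMeasure_nonneg _) (sum_wordMeasure_one w) (sum_wordMeasure_one _)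
    (wordMeasure_conj w) (wordMeasure_conj _) (finRotate n) k _ hD
  have h1 := expected_cycles' hn w hw
  have h2 := expected_cycles' hn _ hu
  rw [wordMeasure_of] at hKR h2
  rw [FreeGroup.toWord_of] at h2
  simp only [List.length_singleton, Nat.cast_one, one_pow, mul_one] at h2
  have hl1 : (1 : ℝ) ≤ w.toWord.length := by
    have : 1 ≤ w.toWord.length := by
      rw [Nat.one_le_iff_ne_zero, Ne, List.length_eq_zero_iff, FreeGroup.toWord_eq_nil_iff]
      exact hw
    exact_mod_cast this
  set l : ℝ := (w.toWord.length : ℝ) with hl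
  have h4 : 1 ≤ l ^ 2 := by nlinarith
  have h5 : (n : ℝ) ^ (-(1 / 3 : ℝ)) ≤ (n : ℝ) ^ (-(1 / 3 : ℝ) + ε) :=
    Real.rpow_le_rpow_of_exponent_le hn' (by linarith)
  have h6 : 0 ≤ (n : ℝ) ^ (-(1 / 3 : ℝ)) := by positivity
  calc KR (wordMeasure (n := n) w) (fun _ => 1 / (n.factorial : ℝ))
      ≤ 18 * l ^ 2 * (n : ℝ) ^ (-(1 / 3 : ℝ)) := by nlinarith
    _ ≤ 18 * l ^ 2 * (n : ℝ) ^ (-(1 / 3 : ℝ) + ε) := by gcongr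
end
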